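/- Poisson-summation identity for the translation operators T_ρ (Appendix B of the paper): Let N ≥ 1 be an integer and F a Schwartz function on R^{2d}. Then for all ρ, ρ′ ∈ R^{2d}, Σ_{r∈Z^{2d}} e^{(iπ/N)⟨r,ρ⟩} F̂(−ρ − Jr) e^{−2iπ⟨Jr, ρ′⟩} = Σ_{r∈Z^{2d}} F(r + ρ′ − Jρ/(2N)) e^{2iπ⟨r+ρ′, ρ⟩}, both series converging absolutely. -/

import Mathlib

open MeasureTheory Matrix
open scoped ComplexConjugate

noncomputable section

/-- The standard symplectic matrix `J = (0, -I; I, 0)` on `ℝ^{2d}`. -/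
def Jmat (d : ℕ) : Matrix (Fin d ⊕ Fin d) (Fin d ⊕ Fin d) ℝ :=
  Matrix.fromBlocks 0 (-1) 1 0

/-- Euclidean inner product on `ℝ^{2d}`. -/
def ip {d : ℕ} (v w : (Fin d ⊕ Fin d) → ℝ) : ℝ := ∑ i, v i * w i

/-- Fourier transform `F̂(ρ) = ∫ F(w) e^{-2iπ⟨ρ,w⟩} dw` on `ℝ^{2d}`. -/
def FT {d : ℕ} (F : ((Fin d ⊕ Fin d) → ℝ) → ℂ) (ρ : (Fin d ⊕ Fin d) → ℝ) : ℂ :=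
  ∫ w : (Fin d ⊕ Fin d) → ℝ, F w * Complex.exp (-(2 * Real.pi * Complex.I) * (ip ρ w : ℝ))

section PoissonSummation

variable {ι : Type*} [Fintype ι]

lemma exists_summable_one_add_norm_intCast_inv_pow :
    ∃ k : ℕ, Summable fun n : ι → ℤ => ((1 + ‖(fun i => (n i : ℝ))‖) ^ k)⁻¹ := by
  classical
  let L := Submodule.span ℤ (Set.range (Pi.basisFun ℝ ι))
  have mem (n : ι → ℤ) : (fun i => (n i : ℝ)) ∈ L :=
    ((Pi.basisFun ℝ ι).mem_span_iff_repr_mem ℤ _).2 fun i => ⟨n i, by simp⟩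
  let k := Module.finrank ℤ L + 1
  have hinj : Function.Injective fun n : ι → ℤ => (⟨_, mem n⟩ : L) := by
    intro m n h
    ext i
    simpa using congr_fun (congr_arg Subtype.val h) i
  have hs := (ZLattice.summable_norm_pow_inv L k (Nat.lt_succ_self _)).comp_injective hinj
  refine ⟨k, (hs.add (hasSum_ite_eq (0 : ι → ℤ) (1 : ℝ)).summable).of_nonneg_of_le
    (fun n => by positivity) fun n => ?_⟩
  by_cases hn : n = 0
  · subst hn
    have : (0 : ℝ) ≤ ‖(⟨_, mem 0⟩ : L)‖⁻¹ ^ k := by positivity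
    have h0 : ‖(fun i => (((0 : ι → ℤ) i : ℤ) : ℝ))‖ = 0 := by
      rw [norm_eq_zero]; ext; simp
    simp only [Function.comp_apply, if_true, h0]
    norm_num at this ⊢
  · have hpos : 0 < ‖(fun i => (n i : ℝ))‖ := by
      rw [norm_pos_iff]
      contrapose! hn
      ext i
      simpa using congr_fun hn i
    simp only [Function.comp_apply, if_neg hn, add_zero, ← inv_pow]
    change _ ≤ ‖(fun i => (n i : ℝ))‖⁻¹ ^ k
    gcongr
    linarith

lemma one_add_norm_le_mul {E : Type*} [SeminormedAddCommGroup E] (x y : E) :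
    1 + ‖y‖ ≤ (1 + ‖x‖) * (1 + ‖x + y‖) := by
  have : ‖y‖ ≤ ‖x + y‖ + ‖x‖ := by simpa using norm_sub_le (x + y) x
  nlinarith [mul_nonneg (norm_nonneg x) (norm_nonneg (x + y))]

/-- Rapid decay of a function on `ι → ℝ`: it is `O((1 + ‖x‖)⁻ᵏ)` for all `k`. -/
def RapidDecay (g : (ι → ℝ) → ℂ) : Prop :=
  ∀ k : ℕ, ∃ C : ℝ, ∀ x, (1 + ‖x‖) ^ k * ‖g x‖ ≤ C

lemma SchwartzMap.rapidDecay (F : SchwartzMap (ι → ℝ) ℂ) : RapidDecay F := fun k =>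
  ⟨_, fun x => by
    simpa using SchwartzMap.one_add_le_sup_seminorm_apply (𝕜 := ℝ) (m := (k, 0)) le_rfl le_rfl F x⟩

namespace RapidDecay

variable {g : (ι → ℝ) → ℂ}

lemma comp_add_left (hg : RapidDecay g) (a : ι → ℝ) : RapidDecay fun x => g (a + x) := by
  intro k
  obtain ⟨C, hC⟩ := hg k
  refine ⟨(1 + ‖a‖) ^ k * C, fun x => ?_⟩
  calc (1 + ‖x‖) ^ k * ‖g (a + x)‖
      ≤ ((1 + ‖a‖) * (1 + ‖a + x‖)) ^ k * ‖g (a + x)‖ := by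
        gcongr
        exact one_add_norm_le_mul a x
    _ = (1 + ‖a‖) ^ k * ((1 + ‖a + x‖) ^ k * ‖g (a + x)‖) := by rw [mul_pow, mul_assoc]
    _ ≤ _ := by gcongr; exact hC _

lemma of_norm_eq {f : (ι → ℝ) → ℂ} (hg : RapidDecay g) (h : ∀ x, ‖f x‖ = ‖g x‖) :
    RapidDecay f := by
  simpa only [RapidDecay, h] using hg

lemma integrable (hg : RapidDecay g) (hc : Continuous g) : Integrable g := by
  obtain ⟨C, hC⟩ := hg (Module.finrank ℝ (ι → ℝ) + 1)
  refine ((integrable_one_add_norm (E := ι → ℝ) (μ := volume)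
    (r := (Module.finrank ℝ (ι → ℝ) + 1 : ℕ)) (by exact_mod_cast Nat.lt_succ_self _)).const_mul
    C).mono' hc.aestronglyMeasurable (.of_forall fun x => ?_)
  rw [Real.rpow_neg (by positivity), Real.rpow_natCast, ← div_eq_mul_inv,
    le_div_iff₀ (by positivity), mul_comm]
  exact hC x

lemma exists_summable_bound (hg : RapidDecay g) (R : ℝ) :
    ∃ u : (ι → ℤ) → ℝ, Summable u ∧
      ∀ n x, ‖x‖ ≤ R → ‖g (x + fun i => (n i : ℝ))‖ ≤ u n := by
  obtain ⟨k, hk⟩ := exists_summable_one_add_norm_intCast_inv_pow (ι := ι)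
  obtain ⟨C, hC⟩ := hg k
  refine ⟨_, hk.mul_left ((1 + R) ^ k * C), fun n x hx => ?_⟩
  set v : ι → ℝ := fun i => (n i : ℝ)
  have hR : 0 ≤ R := (norm_nonneg x).trans hx
  rw [← div_eq_mul_inv, le_div_iff₀ (by positivity), mul_comm]
  calc (1 + ‖v‖) ^ k * ‖g (x + v)‖
      ≤ ((1 + ‖x‖) * (1 + ‖x + v‖)) ^ k * ‖g (x + v)‖ := by
        gcongr
        exact one_add_norm_le_mul x v
    _ = (1 + ‖x‖) ^ k * ((1 + ‖x + v‖) ^ k * ‖g (x + v)‖) := by rw [mul_pow, mul_assoc]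
    _ ≤ _ := by gcongr; exact hC _

lemma summable_norm_add_intCast (hg : RapidDecay g) (x : ι → ℝ) :
    Summable fun n : ι → ℤ => ‖g (x + fun i => (n i : ℝ))‖ := by
  obtain ⟨u, hu, h⟩ := hg.exists_summable_bound ‖x‖
  exact hu.of_nonneg_of_le (fun _ => norm_nonneg _) fun n => h n x le_rfl

lemma continuous_tsum (hg : RapidDecay g) (hc : Continuous g) :
    Continuous fun x => ∑' n : ι → ℤ, g (x + fun i => (n i : ℝ)) := by
  refine continuous_iff_continuousAt.2 fun x => ?_
  obtain ⟨u, hu, h⟩ := hg.exists_summable_bound (‖x‖ + 1)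
  have hball : ContinuousOn (fun x => ∑' n : ι → ℤ, g (x + fun i => (n i : ℝ)))
      {y | ‖y‖ < ‖x‖ + 1} :=
    continuousOn_tsum (fun n => (by fun_prop)) hu fun n y hy => h n y (le_of_lt hy)
  exact hball.continuousAt ((isOpen_lt continuous_norm continuous_const).mem_nhds
    (lt_add_one ‖x‖))

end RapidDecay

/-- Integrals over `ℝ^ι` as sums of integrals over the unit cells of the lattice `ℤ^ι`. -/
lemma hasSum_integral_unitCell {f : (ι → ℝ) → ℂ} (hf : Integrable f) :
    HasSum (fun n : ι → ℤ => ∫ x in {x : ι → ℝ | ∀ i, x i ∈ Set.Ioc (0 : ℝ) (0 + 1)},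
      f (x + fun i => (n i : ℝ))) (∫ x, f x) := by
  let s (n : ι → ℤ) : Set (ι → ℝ) := {x | ∀ i, x i ∈ Set.Ioc (n i : ℝ) (n i + 1)}
  have hm (n) : MeasurableSet (s n) := MeasurableSet.univ_pi' fun i => measurableSet_Ioc
  have hd : Pairwise (Function.onFun Disjoint s) := by
    intro m n hmn
    refine Set.disjoint_left.2 fun x hx hy => hmn ?_
    ext i
    have h1 := hx i
    have h2 := hy i
    have a : (m i : ℝ) < n i + 1 := h1.1.trans_le h2.2
    have b : (n i : ℝ) < m i + 1 := h2.1.trans_le h1.2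
    norm_cast at a b
    omega
  have hU : ⋃ n, s n = Set.univ := by
    refine Set.eq_univ_of_forall fun x => Set.mem_iUnion.2 ⟨fun i => ⌈x i⌉ - 1, fun i => ?_⟩
    have h1 := Int.ceil_lt_add_one (x i)
    have h2 := Int.le_ceil (x i)
    constructor <;> push_cast <;> linarith
  have key := hasSum_integral_iUnion (μ := volume) hm hd (f := f) hf.integrableOn
  rw [hU, setIntegral_univ] at key
  convert! key using 2 with n
  have hp := measurePreserving_add_right (volume : Measure (ι → ℝ)) (fun i => (n i : ℝ))
  rw [← hp.setIntegral_preimage_emb (measurableEmbedding_addRight _) f (s n)]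
  congr 2
  ext x
  simp only [s, Set.mem_ofPred_eq, Set.mem_preimage, Set.mem_Ioc, Pi.add_apply]
  refine forall_congr' fun i => ?_
  constructor <;> rintro ⟨h1, h2⟩ <;> constructor <;> linarith

lemma mFourier_coe_apply (m : ι → ℤ) (x : ι → ℝ) :
    UnitAddTorus.mFourier m (fun i => (x i : UnitAddCircle)) =
      Complex.exp (2 * Real.pi * Complex.I * (∑ i, (m i : ℝ) * x i : ℝ)) := by
  simp only [UnitAddTorus.mFourier, ContinuousMap.coe_mk, fourier_coe_apply, ← Complex.exp_sum]
  congr 1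
  push_cast
  rw [Finset.mul_sum]
  refine Finset.sum_congr rfl fun i _ => ?_
  ring

/-- **Poisson summation** on `ℝ^ι` for continuous functions of rapid decay with summable
Fourier coefficients. -/
theorem RapidDecay.tsum_eq_tsum_fourier {g : (ι → ℝ) → ℂ} (hg : RapidDecay g)
    (hc : Continuous g)
    (hs : Summable fun m : ι → ℤ =>
      ∫ w, g w * Complex.exp (-(2 * Real.pi * Complex.I) * (∑ i, (m i : ℝ) * w i : ℝ)))
    (x : ι → ℝ) :
    ∑' n : ι → ℤ, g (x + fun i => (n i : ℝ)) =
      ∑' m : ι → ℤ,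
        (∫ w, g w * Complex.exp (-(2 * Real.pi * Complex.I) * (∑ i, (m i : ℝ) * w i : ℝ))) *
          Complex.exp (2 * Real.pi * Complex.I * (∑ i, (m i : ℝ) * x i : ℝ)) := by
  let S : C(ι → ℝ, ℂ) := ⟨_, hg.continuous_tsum hc⟩
  let q : C(ι → ℝ, UnitAddTorus ι) :=
    ⟨fun x i => (x i : UnitAddCircle), by fun_prop⟩
  have hq : Topology.IsQuotientMap q :=
    (IsOpenQuotientMap.piMap fun _ : ι =>
      (QuotientAddGroup.isOpenQuotientMap_mk (N := AddSubgroup.zmultiples (1 : ℝ)))).isQuotientMap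
  have hfac : Function.FactorsThrough S q := by
    intro x y hxy
    have (i : ι) : ∃ n : ℤ, y i = x i + n := by
      obtain ⟨n, hn⟩ := (QuotientAddGroup.eq_iff_sub_mem.1 (congr_fun hxy i).symm)
      exact ⟨n, by simp at hn; linarith⟩
    choose n hn using this
    change ∑' k : ι → ℤ, _ = ∑' k : ι → ℤ, _
    rw [← (Equiv.addLeft n).tsum_eq]
    refine tsum_congr fun k => congr_arg g ?_
    ext i
    simp [hn, add_assoc]
  let T : C(UnitAddTorus ι, ℂ) := hq.lift S hfac
  have hT (x : ι → ℝ) : T (fun i => (x i : UnitAddCircle)) =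
      ∑' n : ι → ℤ, g (x + fun i => (n i : ℝ)) := DFunLike.congr_fun (hq.lift_comp S hfac) x
  have hcoeff (m : ι → ℤ) : UnitAddTorus.mFourierCoeff T m =
      ∫ w, g w * Complex.exp (-(2 * Real.pi * Complex.I) * (∑ i, (m i : ℝ) * w i : ℝ)) := by
    let f : (ι → ℝ) → ℂ := fun w =>
      g w * Complex.exp (-(2 * Real.pi * Complex.I) * (∑ i, (m i : ℝ) * w i : ℝ))
    have hfc : Continuous f := by fun_prop
    have hf : RapidDecay f := hg.of_norm_eq fun w => by
      simp only [f, norm_mul, Complex.norm_exp]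
      simp
    have hper (w : ι → ℝ) (n : ι → ℤ) : UnitAddTorus.mFourier (-m)
        (fun i => (w i : UnitAddCircle)) * g (w + fun i => (n i : ℝ)) =
        f (w + fun i => (n i : ℝ)) := by
      have e : (fun i => (w i : UnitAddCircle)) =
          fun i => (((w + fun i => (n i : ℝ)) i : ℝ) : UnitAddCircle) := by
        ext i
        simp
      rw [e, mFourier_coe_apply, mul_comm]
      simp only [f]
      congr 2
      simp only [Pi.neg_apply, Int.cast_neg, neg_mul, Finset.sum_neg_distrib, Complex.ofReal_neg,
        mul_neg]
    rw [UnitAddTorus.mFourierCoeff_eq_integral T m 0]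
    simp_rw [hT, smul_eq_mul, ← tsum_mul_left, hper]
    obtain ⟨u, hu, hb⟩ := hf.exists_summable_bound 1
    let B : Set (ι → ℝ) := {x | ∀ i, x i ∈ Set.Ioc (0 : ℝ) (0 + 1)}
    have hBm : MeasurableSet B := MeasurableSet.univ_pi' fun i => measurableSet_Ioc
    have hint (n : ι → ℤ) : Integrable (fun w => f (w + fun i => (n i : ℝ))) (volume.restrict B) :=
      ((hf.integrable hfc).comp_add_right _).integrableOn
    have hB1 : volume B = 1 := by
      have : B = Set.univ.pi fun _ => Set.Ioc (0 : ℝ) (0 + 1) := by ext; simp [B]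
      rw [this, Real.volume_pi_Ioc]
      simp
    have hsum : Summable fun n : ι → ℤ => ∫ w in B, ‖f (w + fun i => (n i : ℝ))‖ := by
      refine hu.of_nonneg_of_le (fun n => integral_nonneg fun _ => norm_nonneg _) fun n => ?_
      have hle : ∫ w in B, ‖f (w + fun i => (n i : ℝ))‖ ≤ ∫ w in B, u n := by
        refine setIntegral_mono_on (hint n).norm (integrableOn_const (by simp [hB1])) hBm
          fun w hw => hb n w ?_
        refine (pi_norm_le_iff_of_nonneg zero_le_one).2 fun i => ?_
        have := hw i
        rw [Real.norm_eq_abs, abs_of_pos this.1]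
        linarith [this.2]
      simpa [Measure.real, hB1] using hle
    exact (hasSum_integral_of_summable_integral_norm hint hsum).unique
      (hasSum_integral_unitCell (hf.integrable hfc))
  have hsT : Summable (UnitAddTorus.mFourierCoeff T) := by
    rw [funext hcoeff]
    exact hs
  have := (UnitAddTorus.hasSum_mFourier_series_apply_of_summable hsT
    (fun i => (x i : UnitAddCircle))).tsum_eq
  rw [hT] at this
  rw [← this]
  simp_rw [hcoeff, mFourier_coe_apply, smul_eq_mul]

end PoissonSummation

/-- The Fourier transform of a Schwartz function on `ℝ^{2d}` is a Schwartz function. -/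
lemma exists_schwartzMap_eq_FT {d : ℕ} (F : SchwartzMap ((Fin d ⊕ Fin d) → ℝ) ℂ) :
    ∃ G : SchwartzMap ((Fin d ⊕ Fin d) → ℝ) ℂ, ∀ ξ, G ξ = FT (fun w => F w) ξ := by
  let e := EuclideanSpace.equiv (Fin d ⊕ Fin d) ℝ
  refine ⟨SchwartzMap.compCLMOfContinuousLinearEquiv ℂ e.symm
    (FourierTransform.fourier (SchwartzMap.compCLMOfContinuousLinearEquiv ℂ e F)), fun ξ => ?_⟩
  rw [SchwartzMap.compCLMOfContinuousLinearEquiv_apply, Function.comp_apply,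
    SchwartzMap.fourier_coe, Real.fourier_eq', FT,
    ← (PiLp.volume_preserving_ofLp (Fin d ⊕ Fin d)).integral_comp
      (MeasurableEquiv.toLp 2 _).symm.measurableEmbedding]
  refine integral_congr_ae (.of_forall fun w => ?_)
  simp only [smul_eq_mul, SchwartzMap.compCLMOfContinuousLinearEquiv_apply, Function.comp_apply]
  rw [mul_comm]
  congr 2
  simp [e, ip, PiLp.inner_apply]
  ring

/-- The bijection `r ↦ -Jr` of `ℤ^{2d}`. -/
def negJEquiv (d : ℕ) : ((Fin d ⊕ Fin d) → ℤ) ≃ ((Fin d ⊕ Fin d) → ℤ) where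
  toFun r := Sum.elim (fun i => r (.inr i)) fun i => -r (.inl i)
  invFun r := Sum.elim (fun i => -r (.inr i)) fun i => r (.inl i)
  left_inv r := by ext (i | i) <;> simp
  right_inv r := by ext (i | i) <;> simp

lemma Jmat_mulVec {d : ℕ} (v : (Fin d ⊕ Fin d) → ℝ) :
    (Jmat d).mulVec v = Sum.elim (fun i => -v (.inr i)) fun i => v (.inl i) := by
  rw [Jmat, Matrix.fromBlocks_mulVec]
  ext (i | i) <;> simp [Matrix.neg_mulVec]

lemma negJEquiv_cast {d : ℕ} (r : (Fin d ⊕ Fin d) → ℤ) :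
    (fun i => (negJEquiv d r i : ℝ)) = -(Jmat d).mulVec fun i => (r i : ℝ) := by
  rw [Jmat_mulVec]
  ext (i | i) <;> simp [negJEquiv]

lemma ip_add_left {d : ℕ} (u v w : (Fin d ⊕ Fin d) → ℝ) : ip (u + v) w = ip u w + ip v w :=
  add_dotProduct u v w

lemma ip_neg_left {d : ℕ} (v w : (Fin d ⊕ Fin d) → ℝ) : ip (-v) w = -ip v w :=
  neg_dotProduct v w

lemma ip_add_right {d : ℕ} (u v w : (Fin d ⊕ Fin d) → ℝ) : ip u (v + w) = ip u v + ip u w :=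
  dotProduct_add u v w

lemma ip_smul_right {d : ℕ} (c : ℝ) (v w : (Fin d ⊕ Fin d) → ℝ) : ip v (c • w) = c * ip v w :=
  dotProduct_smul c v w

lemma ip_comm {d : ℕ} (v w : (Fin d ⊕ Fin d) → ℝ) : ip v w = ip w v :=
  dotProduct_comm v w

lemma ip_Jmat_mulVec {d : ℕ} (v w : (Fin d ⊕ Fin d) → ℝ) :
    ip ((Jmat d).mulVec v) ((Jmat d).mulVec w) = ip v w := by
  simp [ip, Jmat_mulVec, add_comm]

lemma ip_Jmat_mulVec_self {d : ℕ} (v : (Fin d ⊕ Fin d) → ℝ) :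
    ip v ((Jmat d).mulVec v) = 0 := by
  simp [ip, Jmat_mulVec, mul_comm]

/-- The Fourier transform of a translated and modulated function. -/
lemma FT_translate_modulate {d : ℕ} (f : ((Fin d ⊕ Fin d) → ℝ) → ℂ)
    (a ρ ξ : (Fin d ⊕ Fin d) → ℝ) :
    FT (fun w => f (-a + w) * Complex.exp (2 * Real.pi * Complex.I * (ip w ρ : ℝ))) ξ =
      Complex.exp (-(2 * Real.pi * Complex.I) * (ip (-ρ + ξ) a : ℝ)) * FT f (-ρ + ξ) := by
  simp only [FT]
  rw [← integral_add_left_eq_self _ a, ← integral_const_mul]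
  refine integral_congr_ae (.of_forall fun w => ?_)
  simp only [neg_add_cancel_left]
  have phase : Complex.exp (2 * Real.pi * Complex.I * (ip (a + w) ρ : ℝ)) *
      Complex.exp (-(2 * Real.pi * Complex.I) * (ip ξ (a + w) : ℝ)) =
      Complex.exp (-(2 * Real.pi * Complex.I) * (ip (-ρ + ξ) a : ℝ)) *
        Complex.exp (-(2 * Real.pi * Complex.I) * (ip (-ρ + ξ) w : ℝ)) := by
    rw [← Complex.exp_add, ← Complex.exp_add, ip_comm (a + w) ρ]
    simp only [ip_add_left, ip_add_right, ip_neg_left]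
    congr 1
    push_cast
    ring
  linear_combination f w * phase

/-- **Poisson-summation identity for the translation operators `T_ρ`.**
For a Schwartz function `F` on `ℝ^{2d}` and all `ρ, ρ′ ∈ ℝ^{2d}`,
`∑_{r ∈ ℤ^{2d}} e^{(iπ/N)⟨r,ρ⟩} F̂(−ρ − Jr) e^{−2iπ⟨Jr,ρ′⟩}
   = ∑_{r ∈ ℤ^{2d}} F(r + ρ′ − Jρ/(2N)) e^{2iπ⟨r+ρ′,ρ⟩}`,
both series converging absolutely. -/
theorem poisson_identity_translation_operators
    (d : ℕ) (N : ℕ) (hN : 1 ≤ N)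
    (F : SchwartzMap ((Fin d ⊕ Fin d) → ℝ) ℂ) (ρ ρ' : (Fin d ⊕ Fin d) → ℝ) :
    Summable (fun r : (Fin d ⊕ Fin d) → ℤ =>
        ‖Complex.exp ((Complex.I * Real.pi / N) * (ip (fun i => (r i : ℝ)) ρ : ℝ)) *
            FT (fun w => F w) (-ρ - (Jmat d).mulVec fun i => (r i : ℝ)) *
            Complex.exp (-(2 * Real.pi * Complex.I) *
              (ip ((Jmat d).mulVec fun i => (r i : ℝ)) ρ' : ℝ))‖) ∧
    Summable (fun r : (Fin d ⊕ Fin d) → ℤ =>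
        ‖F (((fun i => (r i : ℝ)) + ρ' - (2 * (N : ℝ))⁻¹ • (Jmat d).mulVec ρ)) *
            Complex.exp ((2 * Real.pi * Complex.I) *
              (ip ((fun i => (r i : ℝ)) + ρ') ρ : ℝ))‖) ∧
    (∑' r : (Fin d ⊕ Fin d) → ℤ,
        Complex.exp ((Complex.I * Real.pi / N) * (ip (fun i => (r i : ℝ)) ρ : ℝ)) *
          FT (fun w => F w) (-ρ - (Jmat d).mulVec fun i => (r i : ℝ)) *
          Complex.exp (-(2 * Real.pi * Complex.I) *
            (ip ((Jmat d).mulVec fun i => (r i : ℝ)) ρ' : ℝ)))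
      = ∑' r : (Fin d ⊕ Fin d) → ℤ,
          F (((fun i => (r i : ℝ)) + ρ' - (2 * (N : ℝ))⁻¹ • (Jmat d).mulVec ρ)) *
            Complex.exp ((2 * Real.pi * Complex.I) *
              (ip ((fun i => (r i : ℝ)) + ρ') ρ : ℝ)) := by
  set a : (Fin d ⊕ Fin d) → ℝ := (2 * (N : ℝ))⁻¹ • (Jmat d).mulVec ρ with ha
  let g : ((Fin d ⊕ Fin d) → ℝ) → ℂ := fun w =>
    F (-a + w) * Complex.exp (2 * Real.pi * Complex.I * (ip w ρ : ℝ))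
  have hgc : Continuous g := by
    have := F.continuous
    unfold g ip
    fun_prop
  have hg : RapidDecay g := (F.rapidDecay.comp_add_left (-a)).of_norm_eq fun w => by
    simp only [g, norm_mul, Complex.norm_exp]
    simp
  obtain ⟨G, hG⟩ := exists_schwartzMap_eq_FT F
  have hFTg (m : (Fin d ⊕ Fin d) → ℤ) : FT g (fun i => (m i : ℝ)) =
      Complex.exp (-(2 * Real.pi * Complex.I) * (ip (-ρ + fun i => (m i : ℝ)) a : ℝ)) *
        G (-ρ + fun i => (m i : ℝ)) := by
    rw [hG]
    exact FT_translate_modulate (fun w => F w) a ρ _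
  have hGs := G.rapidDecay.summable_norm_add_intCast (-ρ)
  have hs : Summable fun m : (Fin d ⊕ Fin d) → ℤ => FT g (fun i => (m i : ℝ)) := by
    refine Summable.of_norm (hGs.congr fun m => ?_)
    rw [hFTg, norm_mul, Complex.norm_exp]
    simp
  have hN0 : (N : ℂ) ≠ 0 := by exact_mod_cast (by omega : N ≠ 0)
  have hleft (r : (Fin d ⊕ Fin d) → ℤ) :
      Complex.exp ((Complex.I * Real.pi / N) * (ip (fun i => (r i : ℝ)) ρ : ℝ)) *
          FT (fun w => F w) (-ρ - (Jmat d).mulVec fun i => (r i : ℝ)) *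
          Complex.exp (-(2 * Real.pi * Complex.I) *
            (ip ((Jmat d).mulVec fun i => (r i : ℝ)) ρ' : ℝ)) =
        FT g (fun i => (negJEquiv d r i : ℝ)) *
          Complex.exp (2 * Real.pi * Complex.I *
            (ip (fun i => (negJEquiv d r i : ℝ)) ρ' : ℝ)) := by
    rw [hFTg, hG, negJEquiv_cast, ← sub_eq_add_neg]
    congr 1
    · congr 2
      rw [sub_eq_add_neg, ip_add_left, ip_neg_left, ip_neg_left, ha, ip_smul_right, ip_smul_right,
        ip_Jmat_mulVec, ip_Jmat_mulVec_self]
      push_cast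
      field_simp
      ring
    · congr 1
      rw [ip_neg_left]
      push_cast
      ring
  have hright (r : (Fin d ⊕ Fin d) → ℤ) :
      F (((fun i => (r i : ℝ)) + ρ' - a)) *
          Complex.exp ((2 * Real.pi * Complex.I) *
            (ip ((fun i => (r i : ℝ)) + ρ') ρ : ℝ)) = g (ρ' + fun i => (r i : ℝ)) := by
    simp only [g]
    rw [add_comm ρ', sub_eq_neg_add]
  simp_rw [hleft, hright]
  refine ⟨?_, hg.summable_norm_add_intCast ρ', ?_⟩
  · refine ((negJEquiv d).summable_iff.2 hs.norm).congr fun r => ?_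
    simp [Complex.norm_exp]
  · rw [(negJEquiv d).tsum_eq fun m => FT g (fun i => (m i : ℝ)) *
      Complex.exp (2 * Real.pi * Complex.I * (ip (fun i => (m i : ℝ)) ρ' : ℝ))]
    exact (hg.tsum_eq_tsum_fourier hgc hs ρ').symm

end
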